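/- Let Σ be a topologically transitive one-sided Markov shift over the countable alphabet ℤ₊ and A : Σ → ℝ a potential of summable variation. Fix x ∈ Ω(A). Then the map u_x : Σ → ℝ defined by u_x(y) = φ_A(x,y) = h_A(x,y) is a continuous sub-action for A (i.e. A + u_x∘σ − u_x ≤ β_A everywhere on Σ) whose ℓ-th variation is bounded above by Var_ℓ^∞(A) for every ℓ ≥ 1. If moreover ∑_{ℓ=1}^∞ Var_ℓ^∞(A) < ∞, then u_x has summable variation; in particular, if A is locally Hölder continuous, then u_x is a locally Hölder continuous sub-action. -/

import Mathlib

open MeasureTheory Filter Set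
open scoped ENNReal

namespace CMS

/-- The one-sided Markov shift `Σ` over the countable alphabet `ℕ = ℤ₊`,
determined by the transition matrix `Tr`. -/
abbrev SS (Tr : ℕ → ℕ → Prop) : Type := {x : ℕ → ℕ // ∀ n, Tr (x n) (x (n + 1))}

/-- The left shift map `σ`. -/
def shiftMap (Tr : ℕ → ℕ → Prop) (x : SS Tr) : SS Tr :=
  ⟨fun n => x.1 (n + 1), fun n => x.2 (n + 1)⟩

open scoped Classical in
/-- The metric `d(x,y) = λ^ℓ`, `ℓ` the first index of disagreement (`0` if `x = y`). -/
noncomputable def sdist (lam : ℝ) {Tr : ℕ → ℕ → Prop} (x y : SS Tr) : ℝ :=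
  if h : ∃ n, x.1 n ≠ y.1 n then lam ^ Nat.find h else 0

/-- Birkhoff sum `S_n f`. -/
noncomputable def birk {Tr : ℕ → ℕ → Prop} (f : SS Tr → ℝ) (n : ℕ) (x : SS Tr) : ℝ :=
  ∑ i ∈ Finset.range n, f ((shiftMap Tr)^[i] x)

/-- `ℓ`-th variation of `f` restricted to a subset `s` (valued in `ℝ≥0∞`). -/
noncomputable def varAtOn (lam : ℝ) {Tr : ℕ → ℕ → Prop} (s : Set (SS Tr))
    (f : SS Tr → ℝ) (ℓ : ℕ) : ℝ≥0∞ :=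
  ⨆ (x ∈ s) (y ∈ s) (_ : sdist lam x y ≤ lam ^ ℓ), ENNReal.ofReal (f x - f y)

/-- `ℓ`-th variation `Var_ℓ(f)`. -/
noncomputable def varAt (lam : ℝ) {Tr : ℕ → ℕ → Prop} (f : SS Tr → ℝ) (ℓ : ℕ) : ℝ≥0∞ :=
  varAtOn lam Set.univ f ℓ

/-- `Var_k^∞(f) = ∑_{ℓ ≥ k} Var_ℓ(f)`. -/
noncomputable def varFrom (lam : ℝ) {Tr : ℕ → ℕ → Prop} (f : SS Tr → ℝ) (k : ℕ) : ℝ≥0∞ :=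
  ∑' ℓ : ℕ, varAt lam f (k + ℓ)

/-- `f` has summable variation: `Var_1^∞(f) < ∞`. -/
def SummableVar (lam : ℝ) {Tr : ℕ → ℕ → Prop} (f : SS Tr → ℝ) : Prop :=
  varFrom lam f 1 < ⊤

/-- `f` is locally Hölder continuous: `Var_ℓ(f) ≤ C λ^ℓ` for all `ℓ ≥ 1`. -/
def LocHolder (lam : ℝ) {Tr : ℕ → ℕ → Prop} (f : SS Tr → ℝ) : Prop :=
  ∃ C : ℝ, 0 < C ∧ ∀ ℓ : ℕ, 1 ≤ ℓ → varAt lam f ℓ ≤ ENNReal.ofReal (C * lam ^ ℓ)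

/-- `‖A - B‖_sv = Var_1^∞(A-B) + ‖A-B‖_∞`. -/
noncomputable def svDist (lam : ℝ) {Tr : ℕ → ℕ → Prop} (A B : SS Tr → ℝ) : ℝ≥0∞ :=
  varFrom lam (fun x => A x - B x) 1 + ⨆ x : SS Tr, ENNReal.ofReal |A x - B x|

/-- `A` is a potential: continuous and bounded from above. -/
def IsPotential {Tr : ℕ → ℕ → Prop} (A : SS Tr → ℝ) : Prop :=
  Continuous A ∧ BddAbove (Set.range A)

/-- Topological transitivity of the shift. -/
def TopTransitive (Tr : ℕ → ℕ → Prop) : Prop :=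
  ∀ U V : Set (SS Tr), IsOpen U → IsOpen V → U.Nonempty → V.Nonempty →
    ∃ n : ℕ, ((shiftMap Tr)^[n] '' U ∩ V).Nonempty

/-- The ergodic maximizing constant `β_A`. -/
noncomputable def beta {Tr : ℕ → ℕ → Prop} (A : SS Tr → ℝ) : ℝ :=
  sSup {r : ℝ | ∃ μ : Measure (SS Tr), IsProbabilityMeasure μ ∧
    μ.map (shiftMap Tr) = μ ∧ r = ∫ x, A x ∂μ}

/-- `μ` is an `A`-maximizing (shift-invariant Borel probability) measure. -/
def Maximizing {Tr : ℕ → ℕ → Prop} (A : SS Tr → ℝ) (μ : Measure (SS Tr)) : Prop :=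
  IsProbabilityMeasure μ ∧ μ.map (shiftMap Tr) = μ ∧ ∫ x, A x ∂μ = beta A

/-- Topological support of a measure. -/
def msupport {Tr : ℕ → ℕ → Prop} (μ : Measure (SS Tr)) : Set (SS Tr) :=
  {x | ∀ U : Set (SS Tr), IsOpen U → x ∈ U → 0 < μ U}

/-- `μ` is the uniform probability measure on a periodic orbit. -/
def PeriodicOrbitMeasure {Tr : ℕ → ℕ → Prop} (μ : Measure (SS Tr)) : Prop :=
  ∃ (y : SS Tr) (p : ℕ), 1 ≤ p ∧ (shiftMap Tr)^[p] y = y ∧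
    μ = (p : ℝ≥0∞)⁻¹ • ∑ i ∈ Finset.range p, Measure.dirac ((shiftMap Tr)^[i] y)

/-- `A` is coercive: `lim_{i→∞} sup A|_[i] = -∞`. -/
def Coercive {Tr : ℕ → ℕ → Prop} (A : SS Tr → ℝ) : Prop :=
  ∀ M : ℝ, ∃ N : ℕ, ∀ i : ℕ, N ≤ i → ∀ x : SS Tr, x.1 0 = i → A x ≤ M

/-- The Aubry set `Ω(A)`. -/
def Aubry (lam : ℝ) {Tr : ℕ → ℕ → Prop} (A : SS Tr → ℝ) : Set (SS Tr) :=
  {x | ∀ ε : ℝ, 0 < ε → ∃ (w : SS Tr) (n : ℕ), 0 < n ∧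
    sdist lam x w < ε ∧ sdist lam ((shiftMap Tr)^[n] w) x < ε ∧
    -ε < (n : ℝ) * beta A - birk A n w ∧ (n : ℝ) * beta A - birk A n w < ε}

/-- The auxiliary function `𝔖^k_l(x,y)` at level `γ`. -/
noncomputable def aux (lam : ℝ) {Tr : ℕ → ℕ → Prop} (A : SS Tr → ℝ) (γ : ℝ)
    (k l : ℕ) (x y : SS Tr) : EReal :=
  ⨅ (n : ℕ) (_ : l ≤ n) (w : SS Tr)
    (_ : sdist lam x w ≤ lam ^ k) (_ : sdist lam ((shiftMap Tr)^[n] w) y ≤ lam ^ k),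
    (((n : ℝ) * γ - birk A n w : ℝ) : EReal)

/-- The Mañé potential `φ^γ_A(x,y)`. -/
noncomputable def mane (lam : ℝ) {Tr : ℕ → ℕ → Prop} (A : SS Tr → ℝ) (γ : ℝ)
    (x y : SS Tr) : EReal :=
  ⨆ k : ℕ, aux lam A γ k 1 x y

/-- The Peierls barrier `h^γ_A(x,y)`. -/
noncomputable def peierls (lam : ℝ) {Tr : ℕ → ℕ → Prop} (A : SS Tr → ℝ) (γ : ℝ)
    (x y : SS Tr) : EReal :=
  ⨆ (k : ℕ) (l : ℕ), aux lam A γ k (l + 1) x y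

section Coordinates

variable {Tr : ℕ → ℕ → Prop}

lemma iterate_shiftMap_apply (n : ℕ) (x : SS Tr) (i : ℕ) :
    ((shiftMap Tr)^[n] x).1 i = x.1 (n + i) := by
  induction n generalizing i with
  | zero => simp
  | succ n ih =>
    rw [Function.iterate_succ_apply']
    change ((shiftMap Tr)^[n] x).1 (i + 1) = _
    rw [ih, Nat.add_right_comm n 1 i, Nat.add_assoc]

/-- `x` and `y` agree on their first `K` coordinates. -/
def AgreeUpTo (K : ℕ) (x y : SS Tr) : Prop := ∀ i < K, x.1 i = y.1 i

lemma sdist_le_pow_iff {lam : ℝ} (h0 : 0 < lam) (h1 : lam < 1) (x y : SS Tr) (K : ℕ) :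
    sdist lam x y ≤ lam ^ K ↔ AgreeUpTo K x y := by
  classical
  unfold sdist AgreeUpTo
  split_ifs with h
  · rw [pow_le_pow_iff_right_of_lt_one₀ h0 h1, Nat.le_find_iff]
    simp
  · push Not at h
    simp [h, (pow_pos h0 K).le]

/-- The point following `w` for `n` steps and `y` afterwards. -/
def splice (n : ℕ) (w y : SS Tr) (h : w.1 n = y.1 0) : SS Tr :=
  ⟨fun i => if i < n then w.1 i else y.1 (i - n), fun i => by
    rcases lt_trichotomy (i + 1) n with hi | hi | hi
    · simpa [hi, (by omega : i < n)] using w.2 i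
    · have := w.2 i
      rw [hi, h] at this
      simpa [hi, (by omega : i < n)] using this
    · have := y.2 (i - n)
      rw [show i - n + 1 = i + 1 - n by omega] at this
      dsimp only
      rwa [if_neg (by omega), if_neg (by omega)]⟩

lemma iterate_shiftMap_splice (n : ℕ) (w y : SS Tr) (h : w.1 n = y.1 0) :
    (shiftMap Tr)^[n] (splice n w y h) = y := by
  ext i
  rw [iterate_shiftMap_apply]
  simp [splice]

lemma agreeUpTo_splice {n K : ℕ} {w y : SS Tr} (h : w.1 n = y.1 0)
    (hK : AgreeUpTo K ((shiftMap Tr)^[n] w) y) : AgreeUpTo (n + K) w (splice n w y h) := by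
  intro i hi
  by_cases hin : i < n
  · simp [splice, hin]
  · have := hK (i - n) (by omega)
    rw [iterate_shiftMap_apply, show n + (i - n) = i by omega] at this
    simpa [splice, hin] using this

/-- The periodic point obtained by repeating the first `n` symbols of `w`. -/
def periodize (n : ℕ) (hn : 0 < n) (w : SS Tr) (h : w.1 n = w.1 0) : SS Tr :=
  ⟨fun i => w.1 (i % n), fun i => by
    have := w.2 (i % n)
    change Tr (w.1 (i % n)) (w.1 ((i + 1) % n))
    rw [← Nat.mod_add_mod]
    rcases Nat.lt_or_ge (i % n + 1) n with hi | hi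
    · rwa [Nat.mod_eq_of_lt hi]
    · have hlt := Nat.mod_lt i hn
      have hi' : i % n + 1 = n := by omega
      rw [hi', h] at this
      rwa [hi', Nat.mod_self]⟩

lemma iterate_shiftMap_periodize (n : ℕ) (hn : 0 < n) (w : SS Tr) (h : w.1 n = w.1 0) :
    (shiftMap Tr)^[n] (periodize n hn w h) = periodize n hn w h := by
  ext i
  rw [iterate_shiftMap_apply]
  simp [periodize]

lemma agreeUpTo_periodize {n K : ℕ} (hn : 0 < n) {w : SS Tr} (h : w.1 n = w.1 0)
    (hK : AgreeUpTo K ((shiftMap Tr)^[n] w) w) :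
    AgreeUpTo (n + K) w (periodize n hn w h) := by
  intro i
  induction i using Nat.strong_induction_on with
  | _ i ih =>
    intro hi
    by_cases hin : i < n
    · simp [periodize, Nat.mod_eq_of_lt hin]
    · have h1 := hK (i - n) (by omega)
      rw [iterate_shiftMap_apply, show n + (i - n) = i by omega] at h1
      rw [h1, ih (i - n) (by omega) (by omega)]
      simp only [periodize]
      rw [← Nat.mod_eq_sub_mod (by omega)]

lemma isOpen_agreeUpTo (K : ℕ) (x : SS Tr) : IsOpen {y : SS Tr | AgreeUpTo K x y} := by
  have : {y : SS Tr | AgreeUpTo K x y} =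
      ⋂ i ∈ Finset.range K, (fun y : SS Tr => y.1 i) ⁻¹' {x.1 i} := by
    ext y
    simp [AgreeUpTo, eq_comm]
  rw [this]
  refine isOpen_biInter_finset fun i _ => (isOpen_discrete _).preimage ?_
  exact (continuous_apply i).comp continuous_subtype_val

lemma exists_path_to (htr : TopTransitive Tr) (x y : SS Tr) :
    ∃ (v : SS Tr) (m : ℕ), v.1 0 = x.1 0 ∧ (shiftMap Tr)^[m] v = y := by
  obtain ⟨m, _, ⟨w, hw, rfl⟩, hy⟩ := htr _ _ (isOpen_agreeUpTo 1 x) (isOpen_agreeUpTo 1 y)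
    ⟨x, fun _ _ => rfl⟩ ⟨y, fun _ _ => rfl⟩
  have h : w.1 m = y.1 0 := by simpa [iterate_shiftMap_apply] using (hy 0 one_pos).symm
  refine ⟨splice m w y h, m, ?_, iterate_shiftMap_splice ..⟩
  rw [← agreeUpTo_splice (K := 1) h (fun i hi => (hy i hi).symm) 0 (by omega)]
  exact (hw 0 one_pos).symm

end Coordinates

section Birkhoff

variable {Tr : ℕ → ℕ → Prop} {A : SS Tr → ℝ}

lemma birk_add (A : SS Tr → ℝ) (n m : ℕ) (w : SS Tr) :
    birk A (n + m) w = birk A n w + birk A m ((shiftMap Tr)^[n] w) := by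
  simp only [birk, Finset.sum_range_add, ← Function.iterate_add_apply]
  congr 1
  exact Finset.sum_congr rfl fun i _ => by rw [add_comm]

lemma iterate_mul_of_periodic {n : ℕ} {p : SS Tr} (hp : (shiftMap Tr)^[n] p = p) (r : ℕ) :
    (shiftMap Tr)^[r * n] p = p := by
  rw [mul_comm, Function.iterate_mul]
  exact Function.iterate_fixed hp r

lemma birk_mul_of_periodic (A : SS Tr → ℝ) {n : ℕ} {p : SS Tr}
    (hp : (shiftMap Tr)^[n] p = p) (r : ℕ) : birk A (r * n) p = r * birk A n p := by
  induction r with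
  | zero => simp [birk]
  | succ r ih =>
    rw [Nat.succ_mul, birk_add, iterate_mul_of_periodic hp, ih]
    push_cast
    ring

lemma measurable_shiftMap : Measurable (shiftMap Tr) := by
  refine Measurable.subtype_mk (measurable_pi_lambda _ fun n => ?_)
  exact (measurable_pi_apply (n + 1)).comp measurable_subtype_coe

/-- Birkhoff sums along periodic orbits are controlled by the ergodic maximizing constant. -/
lemma birk_le_of_periodic (hA : IsPotential A) {n : ℕ} (hn : 0 < n) {p : SS Tr}
    (hp : (shiftMap Tr)^[n] p = p) : birk A n p ≤ n * beta A := by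
  obtain ⟨M, hM⟩ := hA.2
  have hAM : ∀ z, A z ≤ M := fun z => hM ⟨z, rfl⟩
  have hbdd : BddAbove {r : ℝ | ∃ μ : Measure (SS Tr), IsProbabilityMeasure μ ∧
      μ.map (shiftMap Tr) = μ ∧ r = ∫ x, A x ∂μ} := by
    refine ⟨max M 0, ?_⟩
    rintro r ⟨μ, hμ, -, rfl⟩
    by_cases hi : Integrable A μ
    · refine le_max_of_le_left ?_
      calc ∫ x, A x ∂μ ≤ ∫ _, M ∂μ := integral_mono hi (integrable_const M) hAM
        _ = M := by simp
    · rw [integral_undef hi]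
      exact le_max_right ..
  have hn0 : (n : ℝ≥0∞) ≠ 0 := by simpa using hn.ne'
  have hnt : (n : ℝ≥0∞) ≠ ⊤ := ENNReal.natCast_ne_top n
  set ν : Measure (SS Tr) := ∑ i ∈ Finset.range n, Measure.dirac ((shiftMap Tr)^[i] p) with hν
  have hmean : (n : ℝ)⁻¹ * birk A n p ≤ beta A := by
    refine le_csSup hbdd ⟨(n : ℝ≥0∞)⁻¹ • ν, ⟨?_⟩, ?_, ?_⟩
    · simp [hν, ENNReal.inv_mul_cancel hn0 hnt]
    · rw [Measure.map_smul]
      congr 1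
      rw [hν, Measure.map_finset_sum measurable_shiftMap.aemeasurable]
      simp only [Measure.map_dirac, ← Function.iterate_succ_apply']
      have h := Finset.sum_range_succ' (fun i => Measure.dirac ((shiftMap Tr)^[i] p)) n
      rw [Finset.sum_range_succ, hp] at h
      ext s hs
      have h' := congrArg (fun μ : Measure (SS Tr) => μ s) h
      simp only [Measure.add_apply, Function.iterate_zero, id] at h'
      exact ((ENNReal.add_left_inj (measure_ne_top _ s)).1 h').symm
    · rw [integral_smul_measure, hν, integral_finsetSum_measure]
      · simp [birk]
      · intro i _
        exact integrable_dirac (by simp)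
  rwa [inv_mul_le_iff₀ (by exact_mod_cast hn)] at hmean

end Birkhoff

section Variation

variable {lam : ℝ} {Tr : ℕ → ℕ → Prop} {A : SS Tr → ℝ}

lemma ofReal_sub_le_varAt (h0 : 0 < lam) (h1 : lam < 1) (A : SS Tr → ℝ) {x y : SS Tr} {ℓ : ℕ}
    (h : AgreeUpTo ℓ x y) : ENNReal.ofReal (A x - A y) ≤ varAt lam A ℓ :=
  le_iSup₂_of_le x (mem_univ _) <| le_iSup₂_of_le y (mem_univ _) <|
    le_iSup_of_le ((sdist_le_pow_iff h0 h1 x y ℓ).2 h) le_rfl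

lemma varAt_le (h0 : 0 < lam) (h1 : lam < 1) {f : SS Tr → ℝ} {ℓ : ℕ} {C : ℝ≥0∞}
    (h : ∀ x y : SS Tr, AgreeUpTo ℓ x y → ENNReal.ofReal (f x - f y) ≤ C) :
    varAt lam f ℓ ≤ C :=
  iSup₂_le fun x _ => iSup₂_le fun y _ => iSup_le fun hd =>
    h x y ((sdist_le_pow_iff h0 h1 x y ℓ).1 hd)

lemma varFrom_antitone (lam : ℝ) (A : SS Tr → ℝ) : Antitone (varFrom lam A) := by
  refine antitone_nat_of_succ_le fun k => ?_
  unfold varFrom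
  rw [tsum_eq_zero_add' (f := fun ℓ => varAt lam A (k + ℓ)) ENNReal.summable]
  refine le_add_of_nonneg_of_le zero_le (le_of_eq ?_)
  exact tsum_congr fun ℓ => by congr 1; omega

lemma tendsto_varFrom (hA : SummableVar lam A) : Tendsto (varFrom lam A) atTop (nhds 0) := by
  have h := ENNReal.tendsto_sum_nat_add (fun ℓ => varAt lam A (1 + ℓ)) hA.ne
  rw [← tendsto_add_atTop_iff_nat 1]
  refine h.congr fun k => tsum_congr fun ℓ => ?_
  congr 1
  omega

/-- Real-valued tail of the variations. -/
noncomputable def tailVar (lam : ℝ) (A : SS Tr → ℝ) (k : ℕ) : ℝ := (varFrom lam A k).toReal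

lemma varFrom_ne_top (hA : SummableVar lam A) {k : ℕ} (hk : 1 ≤ k) : varFrom lam A k ≠ ⊤ :=
  ((varFrom_antitone lam A hk).trans_lt hA).ne

lemma exists_tailVar_lt (hA : SummableVar lam A) {δ : ℝ} (hδ : 0 < δ) (K : ℕ) :
    ∃ k, K ≤ k ∧ 1 ≤ k ∧ tailVar lam A k < δ := by
  have h : Tendsto (tailVar lam A) atTop (nhds 0) :=
    (ENNReal.tendsto_toReal ENNReal.zero_ne_top).comp (tendsto_varFrom hA)
  obtain ⟨k, hk⟩ := ((h.eventually_lt_const hδ).and (eventually_ge_atTop (max K 1))).exists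
  exact ⟨k, by omega, by omega, hk.1⟩

/-- Bounded distortion: Birkhoff sums along orbits that shadow each other are close. -/
lemma birk_le_birk_add_tailVar (h0 : 0 < lam) (h1 : lam < 1) (hA : SummableVar lam A)
    {n K : ℕ} (hK : 1 ≤ K) {w z : SS Tr} (h : AgreeUpTo (n + K) w z) :
    birk A n w ≤ birk A n z + tailVar lam A K := by
  suffices hE : ENNReal.ofReal (birk A n w - birk A n z) ≤ varFrom lam A K by
    linarith [(ENNReal.ofReal_le_iff_le_toReal (varFrom_ne_top hA hK)).1 hE,
      show tailVar lam A K = (varFrom lam A K).toReal from rfl]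
  rw [birk, birk, ← Finset.sum_sub_distrib]
  calc ENNReal.ofReal (∑ i ∈ Finset.range n,
        (A ((shiftMap Tr)^[i] w) - A ((shiftMap Tr)^[i] z)))
      ≤ ∑ i ∈ Finset.range n,
        ENNReal.ofReal (A ((shiftMap Tr)^[i] w) - A ((shiftMap Tr)^[i] z)) :=
        Finset.le_sum_of_subadditive _ ENNReal.ofReal_zero.le
          (fun _ _ => ENNReal.ofReal_add_le) _ _
    _ ≤ ∑ i ∈ Finset.range n, varAt lam A (K + (n - 1 - i)) := by
        refine Finset.sum_le_sum fun i hi => ofReal_sub_le_varAt h0 h1 A fun j hj => ?_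
        rw [Finset.mem_range] at hi
        rw [iterate_shiftMap_apply, iterate_shiftMap_apply]
        exact h _ (by omega)
    _ = ∑ i ∈ Finset.range n, varAt lam A (K + i) :=
        Finset.sum_range_reflect (fun i => varAt lam A (K + i)) n
    _ ≤ varFrom lam A K := ENNReal.sum_le_tsum _

lemma LocHolder.of_varAt_le_varFrom (h0 : 0 < lam) (h1 : lam < 1) {u : SS Tr → ℝ}
    (hu : ∀ ℓ : ℕ, 1 ≤ ℓ → varAt lam u ℓ ≤ varFrom lam A ℓ) (hA : LocHolder lam A) :
    LocHolder lam u := by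
  obtain ⟨C, hC, h⟩ := hA
  have h1' : 0 < 1 - lam := by linarith
  refine ⟨C / (1 - lam), by positivity, fun ℓ hℓ => (hu ℓ hℓ).trans ?_⟩
  have hs : HasSum (fun j : ℕ => C * lam ^ (ℓ + j)) (C / (1 - lam) * lam ^ ℓ) := by
    have hg := (hasSum_geometric_of_lt_one h0.le h1).mul_left (C * lam ^ ℓ)
    simp only [mul_assoc, ← pow_add] at hg
    rwa [← div_eq_mul_inv, ← mul_div_assoc, mul_div_right_comm] at hg
  rw [← hs.tsum_eq, ENNReal.ofReal_tsum_of_nonneg (fun j => by positivity) hs.summable]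
  exact ENNReal.tsum_le_tsum fun j => h _ (by omega)

end Variation

section Paths

variable {lam : ℝ} {Tr : ℕ → ℕ → Prop} {A : SS Tr → ℝ} {x y : SS Tr}

/-- Near an Aubry point there are arbitrarily long periodic orbits of arbitrarily small cost. -/
lemma exists_periodic_near_aubry (h0 : 0 < lam) (h1 : lam < 1) (hA : SummableVar lam A)
    (hx : x ∈ Aubry lam A) (K l : ℕ) {δ : ℝ} (hδ : 0 < δ) :
    ∃ (p : SS Tr) (N : ℕ), l ≤ N ∧ AgreeUpTo K x p ∧ (shiftMap Tr)^[N] p = p ∧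
      (N : ℝ) * beta A - birk A N p < δ := by
  have hr : (0 : ℝ) < (l : ℝ) + 1 := by positivity
  have hδ' : 0 < δ / (2 * (l + 1)) := by positivity
  obtain ⟨k, hKk, hk, htail⟩ := exists_tailVar_lt hA hδ' K
  obtain ⟨w, n, hn, hxw, hwx, -, hcost⟩ :=
    hx (min (δ / (2 * (l + 1))) (lam ^ k)) (lt_min hδ' (pow_pos h0 k))
  have hxw' := (sdist_le_pow_iff h0 h1 x w k).1 (hxw.trans_le (min_le_right ..)).le
  have hwx' := (sdist_le_pow_iff h0 h1 _ x k).1 (hwx.trans_le (min_le_right ..)).le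
  have hww : AgreeUpTo k ((shiftMap Tr)^[n] w) w := fun i hi => (hwx' i hi).trans (hxw' i hi)
  have hclose : w.1 n = w.1 0 := by simpa [iterate_shiftMap_apply] using hww 0 (by omega)
  set p := periodize n hn w hclose
  have hp : (shiftMap Tr)^[n] p = p := iterate_shiftMap_periodize n hn w hclose
  have hwp : AgreeUpTo (n + k) w p := agreeUpTo_periodize hn hclose hww
  refine ⟨p, (l + 1) * n, by nlinarith, fun i hi => ?_, iterate_mul_of_periodic hp _, ?_⟩
  · rw [hxw' i (by omega), hwp i (by omega)]
  · have hdist := birk_le_birk_add_tailVar h0 h1 hA hk hwp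
    have hcost' := hcost.trans_le (min_le_left _ _)
    rw [birk_mul_of_periodic A hp]
    have hsum : (n : ℝ) * beta A - birk A n p < δ / (2 * (l + 1)) + δ / (2 * (l + 1)) := by
      linarith
    have := mul_lt_mul_of_pos_left hsum hr
    have hδeq : ((l : ℝ) + 1) * (δ / (2 * (l + 1)) + δ / (2 * (l + 1))) = δ := by
      field_simp
      ring
    push_cast
    linarith

/-- There are arbitrarily long orbits of cost less than `c` which start arbitrarily close to `x`
and end at `y`. -/
def ReachableBelow (A : SS Tr → ℝ) (x y : SS Tr) (c : ℝ) : Prop :=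
  ∀ K l : ℕ, ∃ (w : SS Tr) (n : ℕ), l ≤ n ∧ AgreeUpTo K x w ∧ (shiftMap Tr)^[n] w = y ∧
    (n : ℝ) * beta A - birk A n w < c

lemma aux_lt_iff (h0 : 0 < lam) (h1 : lam < 1) (γ c : ℝ) (k l : ℕ) :
    aux lam A γ k l x y < (c : EReal) ↔
      ∃ (n : ℕ) (w : SS Tr), l ≤ n ∧ AgreeUpTo k x w ∧ AgreeUpTo k ((shiftMap Tr)^[n] w) y ∧
        (n : ℝ) * γ - birk A n w < c := by
  simp only [aux, iInf_lt_iff, sdist_le_pow_iff h0 h1, EReal.coe_lt_coe_iff]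
  constructor
  · rintro ⟨n, hn, w, h, h', hc⟩
    exact ⟨n, w, hn, h, h', hc⟩
  · rintro ⟨n, w, hn, h, h', hc⟩
    exact ⟨n, hn, w, h, h', hc⟩

lemma mane_le_peierls (lam : ℝ) (A : SS Tr → ℝ) (γ : ℝ) (x y : SS Tr) :
    mane lam A γ x y ≤ peierls lam A γ x y :=
  iSup_mono fun k => le_iSup (fun l => aux lam A γ k (l + 1) x y) 0

lemma ReachableBelow.peierls_le (h0 : 0 < lam) (h1 : lam < 1) {c : ℝ}
    (h : ReachableBelow A x y c) : peierls lam A (beta A) x y ≤ c := by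
  refine iSup₂_le fun k l => ?_
  obtain ⟨w, n, hn, hxw, hwy, hc⟩ := h k (l + 1)
  exact ((aux_lt_iff h0 h1 _ _ _ _).2 ⟨n, w, hn, hxw, fun i _ => by rw [hwy], hc⟩).le

/-- Moving the endpoint of a family of orbits costs at most the tail of the variations. -/
lemma ReachableBelow.of_approx (h0 : 0 < lam) (h1 : lam < 1) (hA : SummableVar lam A)
    {c : ℝ} {k : ℕ} (hk : 1 ≤ k)
    (h : ∀ K l : ℕ, ∃ (w : SS Tr) (n : ℕ), l ≤ n ∧ AgreeUpTo K x w ∧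
      AgreeUpTo k ((shiftMap Tr)^[n] w) y ∧ (n : ℝ) * beta A - birk A n w < c) :
    ReachableBelow A x y (c + tailVar lam A k) := by
  intro K l
  obtain ⟨w, n, hn, hxw, hwy, hc⟩ := h K (max l K)
  have hj : w.1 n = y.1 0 := by simpa [iterate_shiftMap_apply] using hwy 0 (by omega)
  have hagree := agreeUpTo_splice hj hwy
  refine ⟨splice n w y hj, n, by omega, fun i hi => ?_, iterate_shiftMap_splice .., ?_⟩
  · rw [hxw i hi, hagree i (by omega)]
  · linarith [birk_le_birk_add_tailVar h0 h1 hA hk hagree]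

/-- Prefixing an orbit with a periodic loop near an Aubry point. -/
lemma exists_prefixed_path (h0 : 0 < lam) (h1 : lam < 1) (hA : SummableVar lam A)
    (hx : x ∈ Aubry lam A) {k : ℕ} (hk : 1 ≤ k) {w : SS Tr} (hxw : AgreeUpTo k x w)
    (n K l : ℕ) {δ : ℝ} (hδ : 0 < δ) :
    ∃ (z : SS Tr) (N : ℕ), l ≤ N ∧ AgreeUpTo K x z ∧
      (shiftMap Tr)^[N] z = (shiftMap Tr)^[n] w ∧
      (N : ℝ) * beta A - birk A N z <
        (n : ℝ) * beta A - birk A n w + δ + tailVar lam A k := by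
  obtain ⟨p, N, hN, hxp, hp, hcost⟩ := exists_periodic_near_aubry h0 h1 hA hx (max k K)
    (max l K) hδ
  have hpw : AgreeUpTo k ((shiftMap Tr)^[N] p) w := fun i hi => by
    rw [hp, ← hxp i (by omega), hxw i hi]
  have hj : p.1 N = w.1 0 := by simpa [iterate_shiftMap_apply] using hpw 0 (by omega)
  have hagree := agreeUpTo_splice hj hpw
  have hdist := birk_le_birk_add_tailVar h0 h1 hA hk hagree
  refine ⟨splice N p w hj, N + n, by omega, fun i hi => ?_, ?_, ?_⟩
  · rw [hxp i (by omega), hagree i (by omega)]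
  · rw [add_comm, Function.iterate_add_apply, iterate_shiftMap_splice]
  · rw [birk_add, iterate_shiftMap_splice]
    push_cast
    linarith

lemma ReachableBelow.of_mane_lt (h0 : 0 < lam) (h1 : lam < 1) (hA : SummableVar lam A)
    (hx : x ∈ Aubry lam A) {c : ℝ} (h : mane lam A (beta A) x y < (c : EReal)) :
    ReachableBelow A x y c := by
  obtain ⟨c', hc', hcc'⟩ := EReal.lt_iff_exists_real_btwn.1 h
  have hpos : 0 < (c - c') / 3 := by
    have := EReal.coe_lt_coe_iff.1 hcc'
    linarith
  obtain ⟨k, -, hk, htail⟩ := exists_tailVar_lt hA hpos 0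
  have hap : ReachableBelow A x y
      (c' + (c - c') / 3 + tailVar lam A k + tailVar lam A k) := by
    refine ReachableBelow.of_approx h0 h1 hA hk fun K l => ?_
    obtain ⟨n, w, -, hxw, hwy, hcost⟩ :=
      (aux_lt_iff h0 h1 _ _ _ _).1 ((le_iSup (fun k => aux lam A (beta A) k 1 x y) k).trans_lt hc')
    obtain ⟨z, N, hN, hxz, hz, hcz⟩ := exists_prefixed_path h0 h1 hA hx hk hxw n K l hpos
    exact ⟨z, N, hN, hxz, by rwa [hz], by linarith⟩
  intro K l
  obtain ⟨w, n, hn, hxw, hwy, hcost⟩ := hap K l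
  exact ⟨w, n, hn, hxw, hwy, by linarith⟩

lemma exists_reachableBelow (h0 : 0 < lam) (h1 : lam < 1) (htr : TopTransitive Tr)
    (hA : SummableVar lam A) (hx : x ∈ Aubry lam A) (y : SS Tr) :
    ∃ c, ReachableBelow A x y c := by
  obtain ⟨v, m, hv, hvy⟩ := exists_path_to htr x y
  refine ⟨(m : ℝ) * beta A - birk A m v + 1 + tailVar lam A 1, fun K l => ?_⟩
  have hxv : AgreeUpTo 1 x v := fun i hi => by
    obtain rfl : i = 0 := by omega
    exact hv.symm
  obtain ⟨z, N, hN, hxz, hz, hcz⟩ :=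
    exists_prefixed_path h0 h1 hA hx le_rfl hxv m K l one_pos
  exact ⟨z, N, hN, hxz, hz.trans hvy, hcz⟩

lemma exists_le_of_reachableBelow (h0 : 0 < lam) (h1 : lam < 1) (htr : TopTransitive Tr)
    (hpot : IsPotential A) (hA : SummableVar lam A) (x y : SS Tr) :
    ∃ C : ℝ, ∀ c, ReachableBelow A x y c → C ≤ c := by
  obtain ⟨v, m, hv, hvx⟩ := exists_path_to htr y x
  refine ⟨-((m : ℝ) * beta A - birk A m v) - tailVar lam A 1 - tailVar lam A 1, fun c hc => ?_⟩
  obtain ⟨w, n, hn, hxw, hwy, hcost⟩ := hc 1 1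
  have hwv : AgreeUpTo 1 ((shiftMap Tr)^[n] w) v := fun i hi => by
    obtain rfl : i = 0 := by omega
    rw [hwy, hv]
  have hj : w.1 n = v.1 0 := by simpa [iterate_shiftMap_apply] using hwv 0 one_pos
  set z := splice n w v hj
  have hwz : AgreeUpTo (n + 1) w z := agreeUpTo_splice hj hwv
  have hzn : (shiftMap Tr)^[n] z = v := iterate_shiftMap_splice n w v hj
  have hznm : (shiftMap Tr)^[n + m] z = x := by
    rw [add_comm, Function.iterate_add_apply, hzn, hvx]
  have hloop : AgreeUpTo 1 ((shiftMap Tr)^[n + m] z) z := fun i hi => by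
    rw [hznm, hxw i hi, hwz i (by omega)]
  have hclose : z.1 (n + m) = z.1 0 := by
    simpa [iterate_shiftMap_apply] using hloop 0 one_pos
  have hpos : 0 < n + m := by omega
  have hper := birk_le_of_periodic hpot hpos (iterate_shiftMap_periodize (n + m) hpos z hclose)
  have hd1 := birk_le_birk_add_tailVar h0 h1 hA le_rfl (agreeUpTo_periodize hpos hclose hloop)
  have hd2 := birk_le_birk_add_tailVar h0 h1 hA le_rfl hwz
  rw [birk_add A n m z, hzn] at hd1
  push_cast at hper
  linarith

end Paths

theorem existence_of_sub_action
    (lam : ℝ) (hlam0 : 0 < lam) (hlam1 : lam < 1)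
    (Tr : ℕ → ℕ → Prop) (htr : TopTransitive Tr)
    (A : SS Tr → ℝ) (hA : IsPotential A) (hAsv : SummableVar lam A)
    (x : SS Tr) (hx : x ∈ Aubry lam A) :
    ∃ u : SS Tr → ℝ,
      (∀ y : SS Tr, mane lam A (beta A) x y = (u y : EReal) ∧
        peierls lam A (beta A) x y = (u y : EReal)) ∧
      Continuous u ∧
      (∀ y : SS Tr, A y + u (shiftMap Tr y) - u y ≤ beta A) ∧
      (∀ ℓ : ℕ, 1 ≤ ℓ → varAt lam u ℓ ≤ varFrom lam A ℓ) ∧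
      ((∑' ℓ : ℕ, varFrom lam A (1 + ℓ)) < ⊤ → SummableVar lam u) ∧
      (LocHolder lam A → LocHolder lam u) := by
  have hbot : ∀ y, mane lam A (beta A) x y ≠ ⊥ := fun y hy => by
    obtain ⟨C, hC⟩ := exists_le_of_reachableBelow hlam0 hlam1 htr hA hAsv x y
    have := hC (C - 1) (.of_mane_lt hlam0 hlam1 hAsv hx (hy ▸ EReal.bot_lt_coe _))
    linarith
  have htop : ∀ y, mane lam A (beta A) x y ≠ ⊤ := fun y => by
    obtain ⟨c, hc⟩ := exists_reachableBelow hlam0 hlam1 htr hAsv hx y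
    exact ((mane_le_peierls ..).trans (hc.peierls_le hlam0 hlam1)).trans_lt
      (EReal.coe_lt_top c) |>.ne
  set u : SS Tr → ℝ := fun y => (mane lam A (beta A) x y).toReal
  have hu : ∀ y, mane lam A (beta A) x y = (u y : EReal) := fun y =>
    (EReal.coe_toReal (htop y) (hbot y)).symm
  have hreach : ∀ y c, u y < c → ReachableBelow A x y c := fun y c hc =>
    .of_mane_lt hlam0 hlam1 hAsv hx (by rw [hu]; exact_mod_cast hc)
  have hle : ∀ y c, ReachableBelow A x y c → u y ≤ c := fun y c hc => by
    have := (mane_le_peierls ..).trans (hc.peierls_le hlam0 hlam1)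
    rw [hu] at this
    exact_mod_cast this
  have hvar : ∀ k, 1 ≤ k → ∀ y z, AgreeUpTo k y z → u y - u z ≤ tailVar lam A k := by
    intro k hk y z hyz
    rw [sub_le_iff_le_add']
    refine le_of_forall_pos_le_add fun ε hε => ?_
    have := hle y (u z + ε + tailVar lam A k) <|
      ReachableBelow.of_approx hlam0 hlam1 hAsv hk fun K l => by
        obtain ⟨w, n, hn, hxw, hwz, hc⟩ := hreach z (u z + ε) (by linarith) K l
        exact ⟨w, n, hn, hxw, fun i hi => by rw [hwz, hyz i hi], hc⟩
    linarith
  have hvarAt : ∀ ℓ : ℕ, 1 ≤ ℓ → varAt lam u ℓ ≤ varFrom lam A ℓ := fun ℓ hℓ =>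
    varAt_le hlam0 hlam1 fun y z hyz =>
      (ENNReal.ofReal_le_iff_le_toReal (varFrom_ne_top hAsv hℓ)).2 (hvar ℓ hℓ y z hyz)
  refine ⟨u, fun y => ⟨hu y, le_antisymm ?_ (hu y ▸ mane_le_peierls ..)⟩, ?_, fun y => ?_,
    hvarAt, fun hsum => ?_, LocHolder.of_varAt_le_varFrom hlam0 hlam1 hvarAt⟩
  · refine EReal.le_of_forall_lt_iff_le.1 fun c hc => ?_
    exact (hreach y c (by exact_mod_cast hc)).peierls_le hlam0 hlam1
  · rw [continuous_iff_continuousAt]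
    intro y
    rw [ContinuousAt, Metric.tendsto_nhds]
    intro ε hε
    obtain ⟨k, -, hk, htail⟩ := exists_tailVar_lt hAsv hε 0
    filter_upwards [(isOpen_agreeUpTo k y).mem_nhds (fun _ _ => rfl)] with z hz
    rw [Real.dist_eq, abs_lt]
    have h1 := hvar k hk y z hz
    have h2 := hvar k hk z y fun i hi => (hz i hi).symm
    constructor <;> linarith
  · suffices u (shiftMap Tr y) ≤ u y + (beta A - A y) by linarith
    refine le_of_forall_pos_le_add fun ε hε => hle _ _ fun K l => ?_
    obtain ⟨w, n, hn, hxw, hwy, hc⟩ := hreach y (u y + ε) (by linarith) K l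
    refine ⟨w, n + 1, by omega, hxw, by rw [Function.iterate_succ_apply', hwy], ?_⟩
    rw [birk_add, hwy]
    simp only [birk, Finset.sum_range_one, Function.iterate_zero, id] at hc ⊢
    push_cast
    linarith
  · exact (ENNReal.tsum_le_tsum fun ℓ => hvarAt (1 + ℓ) (by omega)).trans_lt hsum

end CMS
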